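/- Assume the coercivity conditions: S^j = Σ_{i=1}^{j} [κ_{i−1}(u_i−u_{i−1}) + d_i] ≥ 0 for all j = 1,…,n, and S_j = Σ_{i=j}^{n} [κ_i(u_{i+1}−u_i) + d_i] ≥ 0 for all j = 1,…,n. Then the function E attains its global minimum on Ω: there exists ξ̄₀ ∈ Ω with E(ξ̄₀) = inf_{ξ̄ ∈ Ω} E(ξ̄) and this infimum is finite. -/

import Mathlib

open Real Filter Finset

/-- The rescaled Gaussian cumulative distribution function
`F(ξ) = (1/(2√π)) ∫_{-∞}^{ξ} e^{-s²/4} ds`. -/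
noncomputable def F (x : ℝ) : ℝ :=
  (1 / (2 * Real.sqrt Real.pi)) * ∫ s in Set.Iio x, Real.exp (-s ^ 2 / 4)

/-- The derivative `F'(ξ) = (1/(2√π)) e^{-ξ²/4}`. -/
noncomputable def F' (x : ℝ) : ℝ :=
  (1 / (2 * Real.sqrt Real.pi)) * Real.exp (-x ^ 2 / 4)

/-- The functional
`E(ξ̄) = −Σ_{i=0}^{n} k_i(u_{i+1}−u_i) ln(F(ξ_{i+1}/a_i) − F(ξ_i/a_i)) + Σ_{i=1}^{n} d_i ξ_i²/4`,
with the conventions `ξ₀ = −∞`, `ξ_{n+1} = +∞`, i.e. `F(ξ₀/a₀) = 0`, `F(ξ_{n+1}/a_n) = 1`.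
Here `ξ : ℕ → ℝ`, only the values `ξ 1, …, ξ n` being relevant. -/
noncomputable def E (n : ℕ) (u a k d : ℕ → ℝ) (ξ : ℕ → ℝ) : ℝ :=
  -(∑ i ∈ Finset.range (n + 1), k i * (u (i + 1) - u i) *
      Real.log ((if i = n then 1 else F (ξ (i + 1) / a i)) -
        (if i = 0 then 0 else F (ξ i / a i))))
  + ∑ i ∈ Finset.Icc 1 n, d i * ξ i ^ 2 / 4

/-- Reindexing of a point of `ℝⁿ` as the sequence `ξ_1, …, ξ_n` (paper indexing). -/
noncomputable def toSeq (n : ℕ) (x : EuclideanSpace ℝ (Fin n)) : ℕ → ℝ :=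
  fun i => if h : i - 1 < n then x ⟨i - 1, h⟩ else 0

/-- The left-hand side of the `i`-th equation (`1 ≤ i ≤ n`) of the Stefan system:
`d_i ξ_i/2 + k_i(u_{i+1}−u_i) F'(ξ_i/a_i)/(a_i (F(ξ_{i+1}/a_i) − F(ξ_i/a_i)))
 − k_{i−1}(u_i−u_{i−1}) F'(ξ_i/a_{i−1})/(a_{i−1} (F(ξ_i/a_{i−1}) − F(ξ_{i−1}/a_{i−1})))`,
with the conventions `ξ₀ = −∞` (so `F(ξ₀/a₀) = 0`) and `ξ_{n+1} = +∞` (so `F(ξ_{n+1}/a_n) = 1`). -/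
noncomputable def stefanLHS (n : ℕ) (u a k d : ℕ → ℝ) (ξ : ℕ → ℝ) (i : ℕ) : ℝ :=
  d i * ξ i / 2
  + k i * (u (i + 1) - u i) * F' (ξ i / a i) /
      (a i * ((if i = n then 1 else F (ξ (i + 1) / a i)) - F (ξ i / a i)))
  - k (i - 1) * (u i - u (i - 1)) * F' (ξ i / a (i - 1)) /
      (a (i - 1) * (F (ξ i / a (i - 1)) - (if i = 1 then 0 else F (ξ (i - 1) / a (i - 1)))))

open MeasureTheory

lemma integrable_exp_neg_sq_div_four : Integrable fun s : ℝ => Real.exp (-s ^ 2 / 4) := by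
  have h := integrable_exp_neg_mul_sq (b := 1 / 4) (by norm_num)
  refine h.congr (Eventually.of_forall fun s => ?_)
  simp only
  congr 1
  ring

lemma integral_exp_neg_sq_div_four : ∫ s : ℝ, Real.exp (-s ^ 2 / 4) = 2 * √π := by
  have h := integral_gaussian (1 / 4)
  have h4 : √(π / (1 / 4)) = 2 * √π := by
    rw [show π / (1 / 4) = 2 ^ 2 * π by ring, Real.sqrt_mul (by norm_num),
      Real.sqrt_sq (by norm_num)]
  rw [← h4, ← h]
  congr 1
  funext s
  congr 1
  ring

lemma F_sub_eq (x y : ℝ) :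
    F y - F x = (1 / (2 * √π)) * ∫ s in x..y, Real.exp (-s ^ 2 / 4) := by
  rw [F, F, ← mul_sub, ← integral_Iic_eq_integral_Iio, ← integral_Iic_eq_integral_Iio,
    intervalIntegral.integral_Iic_sub_Iic integrable_exp_neg_sq_div_four.integrableOn
      integrable_exp_neg_sq_div_four.integrableOn]

lemma F_continuous : Continuous F := by
  have h : F = fun y => F 0 + (1 / (2 * √π)) * ∫ s in (0 : ℝ)..y, Real.exp (-s ^ 2 / 4) := by
    funext y
    rw [← F_sub_eq]
    ring
  rw [h]
  exact continuous_const.add (continuous_const.mul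
    (intervalIntegral.continuous_primitive
      (fun _ _ => integrable_exp_neg_sq_div_four.intervalIntegrable) 0))

lemma F_strictMono : StrictMono F := by
  intro x y hxy
  rw [← sub_pos, F_sub_eq]
  refine mul_pos (by positivity) ?_
  exact intervalIntegral.intervalIntegral_pos_of_pos
    integrable_exp_neg_sq_div_four.intervalIntegrable (fun _ => Real.exp_pos _) hxy

lemma F_nonneg (x : ℝ) : 0 ≤ F x :=
  mul_nonneg (by positivity) (integral_nonneg fun _ => (Real.exp_pos _).le)

lemma F_pos (x : ℝ) : 0 < F x :=
  (F_nonneg (x - 1)).trans_lt (F_strictMono (by linarith))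

lemma F_neg (x : ℝ) : F (-x) = 1 - F x := by
  have h1 : ∫ s in Set.Iio (-x), Real.exp (-s ^ 2 / 4)
      = ∫ s in Set.Ioi x, Real.exp (-s ^ 2 / 4) := by
    rw [← integral_Iic_eq_integral_Iio,
      ← integral_comp_neg_Ioi x fun s : ℝ => Real.exp (-s ^ 2 / 4)]
    simp
  have h2 := intervalIntegral.integral_Iic_add_Ioi (b := x)
    integrable_exp_neg_sq_div_four.integrableOn integrable_exp_neg_sq_div_four.integrableOn
  rw [integral_exp_neg_sq_div_four, integral_Iic_eq_integral_Iio] at h2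
  have hpi : 0 < √π := Real.sqrt_pos.mpr Real.pi_pos
  rw [F, F, h1, eq_sub_iff_add_eq, ← mul_add, add_comm, h2]
  field_simp

lemma F_lt_one (x : ℝ) : F x < 1 := by
  have := F_pos (-x)
  rw [F_neg] at this
  linarith

lemma F_le_exp {x : ℝ} (hx : x ≤ 0) : F x ≤ Real.exp (-x ^ 2 / 4) := by
  have hpi : 0 < √π := Real.sqrt_pos.mpr Real.pi_pos
  have hint : Integrable fun s : ℝ => Real.exp (-x ^ 2 / 4) * Real.exp (-(s - x) ^ 2 / 4) :=
    (integrable_exp_neg_sq_div_four.comp_sub_right x).const_mul _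
  have h : ∫ s in Set.Iio x, Real.exp (-s ^ 2 / 4) ≤ Real.exp (-x ^ 2 / 4) * (2 * √π) := by
    calc ∫ s in Set.Iio x, Real.exp (-s ^ 2 / 4)
        ≤ ∫ s in Set.Iio x, Real.exp (-x ^ 2 / 4) * Real.exp (-(s - x) ^ 2 / 4) := by
          refine setIntegral_mono_on integrable_exp_neg_sq_div_four.integrableOn
            hint.integrableOn measurableSet_Iio fun s hs => ?_
          rw [← Real.exp_add]
          refine Real.exp_le_exp.mpr ?_
          have hs : s < x := hs
          nlinarith [mul_nonneg_of_nonpos_of_nonpos hx (sub_nonpos.mpr hs.le)]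
      _ ≤ ∫ s, Real.exp (-x ^ 2 / 4) * Real.exp (-(s - x) ^ 2 / 4) :=
          setIntegral_le_integral hint (Eventually.of_forall fun s => by positivity)
      _ = Real.exp (-x ^ 2 / 4) * (2 * √π) := by
          rw [integral_const_mul,
            integral_sub_right_eq_self (fun s : ℝ => Real.exp (-s ^ 2 / 4)) x,
            integral_exp_neg_sq_div_four]
  calc F x ≤ 1 / (2 * √π) * (Real.exp (-x ^ 2 / 4) * (2 * √π)) :=
        mul_le_mul_of_nonneg_left h (by positivity)
    _ = Real.exp (-x ^ 2 / 4) := by field_simp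

lemma neg_mul_F_le_exp (x : ℝ) : -x * F x ≤ Real.exp (-x ^ 2 / 4) := by
  have hpi : 1 ≤ √π := Real.one_le_sqrt.mpr (by linarith [Real.pi_gt_three])
  have hderiv : ∀ s : ℝ, HasDerivAt (fun s : ℝ => 2 * Real.exp (-s ^ 2 / 4))
      (-s * Real.exp (-s ^ 2 / 4)) s := by
    intro s
    have h : HasDerivAt (fun s : ℝ => -s ^ 2 / 4) (-(2 * s) / 4) s := by
      simpa using ((hasDerivAt_pow 2 s).neg.div_const 4)
    exact (h.exp.const_mul 2).congr_deriv (by ring)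
  have hint : Integrable fun s : ℝ => -s * Real.exp (-s ^ 2 / 4) := by
    refine (integrable_mul_exp_neg_mul_sq (b := 1 / 4) (by norm_num)).neg.congr
      (Eventually.of_forall fun s => ?_)
    simp only [Pi.neg_apply, neg_mul]
    congr 3
    ring
  have htend : Tendsto (fun s : ℝ => 2 * Real.exp (-s ^ 2 / 4)) atBot (nhds 0) := by
    have h : Tendsto (fun s : ℝ => -s ^ 2 / 4) atBot atBot := by
      have h2 : Tendsto (fun s : ℝ => s ^ 2) atBot atTop := by
        simpa [Function.comp_def] using
          (tendsto_pow_atTop (α := ℝ) two_ne_zero).comp tendsto_neg_atBot_atTop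
      exact (tendsto_neg_atTop_atBot.comp h2).atBot_div_const (by norm_num)
    simpa using (Real.tendsto_exp_atBot.comp h).const_mul 2
  have hval : ∫ s in Set.Iio x, -s * Real.exp (-s ^ 2 / 4) = 2 * Real.exp (-x ^ 2 / 4) := by
    rw [← integral_Iic_eq_integral_Iio,
      integral_Iic_of_hasDerivAt_of_tendsto' (fun s _ => hderiv s) hint.integrableOn htend, sub_zero]
  have h : -x * ∫ s in Set.Iio x, Real.exp (-s ^ 2 / 4) ≤ 2 * Real.exp (-x ^ 2 / 4) := by
    rw [← hval, ← integral_const_mul]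
    refine setIntegral_mono_on (integrable_exp_neg_sq_div_four.const_mul _).integrableOn
      hint.integrableOn measurableSet_Iio fun s hs => ?_
    have hs : s < x := hs
    exact mul_le_mul_of_nonneg_right (by linarith) (Real.exp_pos _).le
  have he := Real.exp_pos (-x ^ 2 / 4)
  calc -x * F x = 1 / (2 * √π) * (-x * ∫ s in Set.Iio x, Real.exp (-s ^ 2 / 4)) := by
        rw [F]; ring
    _ ≤ 1 / (2 * √π) * (2 * Real.exp (-x ^ 2 / 4)) :=
        mul_le_mul_of_nonneg_left h (by positivity)
    _ = Real.exp (-x ^ 2 / 4) / √π := by field_simp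
    _ ≤ Real.exp (-x ^ 2 / 4) := div_le_self he.le hpi

lemma log_F_le (x : ℝ) : Real.log (F x) ≤ -(min x 0) ^ 2 / 4 := by
  rw [Real.log_le_iff_le_exp (F_pos x)]
  rcases le_total x 0 with h | h
  · rw [min_eq_left h]
    exact F_le_exp h
  · rw [min_eq_right h]
    simpa using (F_lt_one x).le

lemma log_one_sub_F_le (x : ℝ) : Real.log (1 - F x) ≤ -(max x 0) ^ 2 / 4 := by
  have h := log_F_le (-x)
  have h2 : min (-x) 0 = -max x 0 := by rw [← min_neg_neg, neg_zero]
  rwa [F_neg, h2, neg_sq] at h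

lemma log_F_sub_F_le {x y : ℝ} (hxy : x < y) :
    Real.log (F y - F x) ≤ -(min y 0) ^ 2 / 4 - (max x 0) ^ 2 / 4 := by
  have hpos : 0 < F y - F x := sub_pos.mpr (F_strictMono hxy)
  rcases le_total y 0 with h | h
  · rw [max_eq_right (by linarith : x ≤ 0)]
    have := Real.log_le_log hpos (by linarith [F_pos x] : F y - F x ≤ F y)
    linarith [log_F_le y]
  · rw [min_eq_right h]
    have := Real.log_le_log hpos (by linarith [F_lt_one y] : F y - F x ≤ 1 - F x)
    linarith [log_one_sub_F_le x]

lemma neg_le_exp_of_log_F {x c : ℝ} (h : -Real.log (F x) - (min x 0) ^ 2 / 4 ≤ c) :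
    -x ≤ Real.exp c := by
  rcases le_or_gt 0 x with hx | hx
  · linarith [Real.exp_pos c]
  · rw [min_eq_left hx.le] at h
    have h1 := Real.log_le_log (mul_pos (neg_pos.mpr hx) (F_pos x)) (neg_mul_F_le_exp x)
    rw [Real.log_mul (neg_pos.mpr hx).ne' (F_pos x).ne', Real.log_exp] at h1
    rw [← Real.log_le_iff_le_exp (neg_pos.mpr hx)]
    linarith

/-- Abel summation: a sequence with nonnegative partial sums paired with a nonnegative
antitone weight has nonnegative sum. -/
lemma sum_mul_nonneg_of_antitone {n : ℕ} (hn : 1 ≤ n) (b p : ℕ → ℝ)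
    (hb : ∀ j, 1 ≤ j → j ≤ n → 0 ≤ ∑ i ∈ Finset.Icc 1 j, b i) (hp : ∀ i, 0 ≤ p i)
    (hanti : ∀ i, 1 ≤ i → i < n → p (i + 1) ≤ p i) :
    0 ≤ ∑ i ∈ Finset.Icc 1 n, b i * p i := by
  have key : ∀ m, 1 ≤ m → m ≤ n →
      (∑ i ∈ Finset.Icc 1 m, b i) * p m ≤ ∑ i ∈ Finset.Icc 1 m, b i * p i := by
    intro m hm
    induction m, hm using Nat.le_induction with
    | base => simp
    | succ m hm ih =>
      intro hmn
      rw [Finset.sum_Icc_succ_top (by omega), Finset.sum_Icc_succ_top (by omega)]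
      have h1 := ih (by omega)
      have h2 := mul_le_mul_of_nonneg_left (hanti m hm (by omega)) (hb m hm (by omega))
      linarith
  exact (mul_nonneg (hb n hn le_rfl) (hp n)).trans (key n hn le_rfl)

lemma sum_mul_nonneg_of_monotone {n : ℕ} (hn : 1 ≤ n) (b q : ℕ → ℝ)
    (hb : ∀ j, 1 ≤ j → j ≤ n → 0 ≤ ∑ i ∈ Finset.Icc j n, b i) (hq : ∀ i, 0 ≤ q i)
    (hmono : ∀ i, 1 ≤ i → i < n → q i ≤ q (i + 1)) :
    0 ≤ ∑ i ∈ Finset.Icc 1 n, b i * q i := by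
  have key : ∀ m, m ≤ n → 1 ≤ m →
      (∑ i ∈ Finset.Icc m n, b i) * q m ≤ ∑ i ∈ Finset.Icc m n, b i * q i := by
    intro m hm
    induction hm using Nat.decreasingInduction with
    | self => simp
    | of_succ m hm ih =>
      intro h1m
      rw [← Finset.add_sum_Ioc_eq_sum_Icc hm.le, ← Finset.add_sum_Ioc_eq_sum_Icc hm.le,
        ← Finset.Icc_succ_left_eq_Ioc, Nat.succ_eq_succ]
      have h1 := ih (by omega)
      have h2 := mul_le_mul_of_nonneg_left (hmono m h1m hm) (hb (m + 1) (by omega) hm)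
      simp only [Nat.succ_eq_add_one]
      linarith
  exact (mul_nonneg (hb 1 le_rfl hn) (hq 1)).trans (key 1 hn le_rfl)

/-- The `i`-th increment `F(ξ_{i+1}/a_i) − F(ξ_i/a_i)`, with the conventions `ξ₀ = −∞` and
`ξ_{n+1} = +∞`. -/
noncomputable def incr (n : ℕ) (a ξ : ℕ → ℝ) (i : ℕ) : ℝ :=
  (if i = n then 1 else F (ξ (i + 1) / a i)) - (if i = 0 then 0 else F (ξ i / a i))

/-- The Gaussian rate of decay of the `i`-th increment. -/
noncomputable def incrRate (n : ℕ) (a ξ : ℕ → ℝ) (i : ℕ) : ℝ :=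
  (if i = n then 0 else (min (ξ (i + 1) / a i) 0) ^ 2 / 4) +
    (if i = 0 then 0 else (max (ξ i / a i) 0) ^ 2 / 4)

lemma E_eq (n : ℕ) (u a k d ξ : ℕ → ℝ) :
    E n u a k d ξ = ∑ i ∈ Finset.range (n + 1), k i * (u (i + 1) - u i) * -Real.log (incr n a ξ i)
      + ∑ i ∈ Finset.Icc 1 n, d i * ξ i ^ 2 / 4 := by
  simp only [E, incr, mul_neg, Finset.sum_neg_distrib]

section

variable {n : ℕ} {a ξ : ℕ → ℝ}

lemma incr_pos (hn : 1 ≤ n) (ha : ∀ i ≤ n, 0 < a i)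
    (hξ : ∀ i, 1 ≤ i → i < n → ξ i < ξ (i + 1)) {i : ℕ} (hi : i ≤ n) : 0 < incr n a ξ i := by
  unfold incr
  split_ifs with h1 h2 h2
  · norm_num
  · linarith [F_lt_one (ξ i / a i)]
  · linarith [F_pos (ξ (i + 1) / a i)]
  · exact sub_pos.mpr (F_strictMono
      (div_lt_div_of_pos_right (hξ i (by omega) (by omega)) (ha i hi)))

lemma incr_le_one (i : ℕ) : incr n a ξ i ≤ 1 := by
  have h1 := F_lt_one (ξ (i + 1) / a i)
  have h2 := F_pos (ξ i / a i)
  unfold incr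
  split_ifs <;> linarith

lemma incrRate_le (hn : 1 ≤ n) (ha : ∀ i ≤ n, 0 < a i)
    (hξ : ∀ i, 1 ≤ i → i < n → ξ i < ξ (i + 1)) {i : ℕ} (hi : i ≤ n) :
    incrRate n a ξ i ≤ -Real.log (incr n a ξ i) := by
  unfold incr incrRate
  split_ifs with h1 h2 h2
  · omega
  · linarith [log_one_sub_F_le (ξ i / a i)]
  · rw [sub_zero]
    linarith [log_F_le (ξ (i + 1) / a i)]
  · linarith [log_F_sub_F_le
      (div_lt_div_of_pos_right (hξ i (by omega) (by omega)) (ha i hi))]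

lemma sum_mul_incrRate (w : ℕ → ℝ) (ha : ∀ i ≤ n, 0 < a i) :
    ∑ i ∈ Finset.range (n + 1), w i * incrRate n a ξ i =
      ∑ i ∈ Finset.Icc 1 n, w (i - 1) / a (i - 1) ^ 2 * ((min (ξ i) 0) ^ 2 / 4) +
        ∑ i ∈ Finset.Icc 1 n, w i / a i ^ 2 * ((max (ξ i) 0) ^ 2 / 4) := by
  simp only [incrRate, mul_add, Finset.sum_add_distrib]
  have hIcc : ∀ f : ℕ → ℝ, ∑ i ∈ Finset.Icc 1 n, f i = ∑ i ∈ Finset.range n, f (i + 1) := by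
    intro f
    rw [Finset.range_eq_Ico, Finset.sum_Ico_add' f 0 n 1, zero_add]
    rfl
  congr 1
  · rw [Finset.sum_range_succ, if_pos rfl, mul_zero, add_zero, hIcc]
    refine Finset.sum_congr rfl fun i hi => ?_
    have hi := Finset.mem_range.mp hi
    have hai := ha i hi.le
    have hmin : min (ξ (i + 1) / a i) 0 = min (ξ (i + 1)) 0 / a i := by
      rw [← min_div_div_right hai.le, zero_div]
    rw [if_neg hi.ne, hmin, add_tsub_cancel_right]
    field_simp
  · rw [Finset.sum_range_succ', if_pos rfl, mul_zero, add_zero, hIcc]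
    refine Finset.sum_congr rfl fun i hi => ?_
    have hi := Finset.mem_range.mp hi
    have hai := ha (i + 1) hi
    have hmax : max (ξ (i + 1) / a (i + 1)) 0 = max (ξ (i + 1)) 0 / a (i + 1) := by
      rw [← max_div_div_right hai.le, zero_div]
    rw [if_neg (Nat.succ_ne_zero i), hmax]
    field_simp

variable {u k d : ℕ → ℝ}

lemma mul_neg_log_incr_sub_incrRate_le_E (hn : 1 ≤ n)
    (hu : ∀ i ≤ n, u i < u (i + 1)) (ha : ∀ i ≤ n, 0 < a i) (hk : ∀ i ≤ n, 0 < k i)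
    (hS1 : ∀ j, 1 ≤ j → j ≤ n →
      0 ≤ ∑ i ∈ Finset.Icc 1 j, (k (i - 1) / a (i - 1) ^ 2 * (u i - u (i - 1)) + d i))
    (hS2 : ∀ j, 1 ≤ j → j ≤ n →
      0 ≤ ∑ i ∈ Finset.Icc j n, (k i / a i ^ 2 * (u (i + 1) - u i) + d i))
    (hξ : ∀ i, 1 ≤ i → i < n → ξ i < ξ (i + 1)) {i : ℕ} (hi : i ≤ n) :
    k i * (u (i + 1) - u i) * (-Real.log (incr n a ξ i) - incrRate n a ξ i)
      ≤ E n u a k d ξ := by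
  have hP := sum_mul_nonneg_of_antitone hn _ (fun i => (min (ξ i) 0) ^ 2 / 4) hS1
    (fun i => by positivity) fun i h1 h2 => by
      have h : min (ξ i) 0 ≤ min (ξ (i + 1)) 0 := min_le_min_right 0 (hξ i h1 h2).le
      have h0 : min (ξ (i + 1)) 0 ≤ 0 := min_le_right _ _
      nlinarith
  have hQ := sum_mul_nonneg_of_monotone hn _ (fun i => (max (ξ i) 0) ^ 2 / 4) hS2
    (fun i => by positivity) fun i h1 h2 => by
      have h : max (ξ i) 0 ≤ max (ξ (i + 1)) 0 := max_le_max_right 0 (hξ i h1 h2).le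
      have h0 : 0 ≤ max (ξ i) 0 := le_max_right _ _
      nlinarith
  have hw : ∀ i ≤ n, 0 < k i * (u (i + 1) - u i) := fun i hi =>
    mul_pos (hk i hi) (sub_pos.mpr (hu i hi))
  have hsum : E n u a k d ξ =
      ∑ i ∈ Finset.range (n + 1),
        k i * (u (i + 1) - u i) * (-Real.log (incr n a ξ i) - incrRate n a ξ i)
      + (∑ i ∈ Finset.Icc 1 n, (k (i - 1) / a (i - 1) ^ 2 * (u i - u (i - 1)) + d i)
          * ((min (ξ i) 0) ^ 2 / 4)
        + ∑ i ∈ Finset.Icc 1 n, (k i / a i ^ 2 * (u (i + 1) - u i) + d i)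
          * ((max (ξ i) 0) ^ 2 / 4)) := by
    have hIcc : ∑ i ∈ Finset.Icc 1 n, (k (i - 1) / a (i - 1) ^ 2 * (u i - u (i - 1)) + d i)
          * ((min (ξ i) 0) ^ 2 / 4)
        + ∑ i ∈ Finset.Icc 1 n, (k i / a i ^ 2 * (u (i + 1) - u i) + d i)
          * ((max (ξ i) 0) ^ 2 / 4) =
        ∑ i ∈ Finset.range (n + 1), k i * (u (i + 1) - u i) * incrRate n a ξ i
          + ∑ i ∈ Finset.Icc 1 n, d i * ξ i ^ 2 / 4 := by
      rw [sum_mul_incrRate (fun i => k i * (u (i + 1) - u i)) ha]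
      simp only [← Finset.sum_add_distrib]
      refine Finset.sum_congr rfl fun i hi => ?_
      have hsq : ξ i ^ 2 = (min (ξ i) 0) ^ 2 + (max (ξ i) 0) ^ 2 := by
        rcases le_total (ξ i) 0 with h | h <;> simp [h]
      rw [hsq, Nat.sub_add_cancel (Finset.mem_Icc.mp hi).1]
      ring
    rw [hIcc, E_eq, ← add_assoc, ← Finset.sum_add_distrib]
    congr 1
    refine Finset.sum_congr rfl fun i _ => ?_
    ring
  have hle := Finset.single_le_sum
    (f := fun i => k i * (u (i + 1) - u i) * (-Real.log (incr n a ξ i) - incrRate n a ξ i))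
    (fun i hi => by
      have hi : i ≤ n := Nat.lt_succ_iff.mp (Finset.mem_range.mp hi)
      exact mul_nonneg (hw i hi).le (sub_nonneg.mpr (incrRate_le hn ha hξ hi)))
    (Finset.mem_range.mpr (Nat.lt_succ_of_le hi))
  rw [hsum]
  linarith

lemma abs_le_of_E_le (hn : 1 ≤ n)
    (hu : ∀ i ≤ n, u i < u (i + 1)) (ha : ∀ i ≤ n, 0 < a i) (hk : ∀ i ≤ n, 0 < k i)
    (hS1 : ∀ j, 1 ≤ j → j ≤ n →
      0 ≤ ∑ i ∈ Finset.Icc 1 j, (k (i - 1) / a (i - 1) ^ 2 * (u i - u (i - 1)) + d i))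
    (hS2 : ∀ j, 1 ≤ j → j ≤ n →
      0 ≤ ∑ i ∈ Finset.Icc j n, (k i / a i ^ 2 * (u (i + 1) - u i) + d i))
    (hξ : StrictMonoOn ξ (Set.Icc 1 n)) {c : ℝ} (hc : E n u a k d ξ ≤ c)
    {i : ℕ} (h1i : 1 ≤ i) (hi : i ≤ n) :
    |ξ i| ≤ max (a 0 * Real.exp (c / (k 0 * (u 1 - u 0))))
      (a n * Real.exp (c / (k n * (u (n + 1) - u n)))) := by
  have hstep : ∀ i, 1 ≤ i → i < n → ξ i < ξ (i + 1) := fun i h1 h2 =>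
    hξ ⟨h1, h2.le⟩ ⟨by omega, h2⟩ (Nat.lt_succ_self i)
  have hlower := mul_neg_log_incr_sub_incrRate_le_E hn hu ha hk hS1 hS2 hstep (Nat.zero_le n)
  have hupper := mul_neg_log_incr_sub_incrRate_le_E hn hu ha hk hS1 hS2 hstep le_rfl
  have hw : ∀ i ≤ n, 0 < k i * (u (i + 1) - u i) := fun i hi =>
    mul_pos (hk i hi) (sub_pos.mpr (hu i hi))
  have hn0 : n ≠ 0 := by omega
  have ha0 := ha 0 (Nat.zero_le n)
  have han := ha n le_rfl
  simp only [incr, incrRate, hn0, hn0.symm, if_true, if_false, sub_zero, add_zero, zero_add]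
    at hlower hupper
  have h0 : -(ξ 1 / a 0) ≤ Real.exp (c / (k 0 * (u 1 - u 0))) := by
    refine neg_le_exp_of_log_F ((le_div_iff₀' (hw 0 (Nat.zero_le n))).mpr ?_)
    exact hlower.trans hc
  have hn' : -(-(ξ n / a n)) ≤ Real.exp (c / (k n * (u (n + 1) - u n))) := by
    refine neg_le_exp_of_log_F ((le_div_iff₀' (hw n le_rfl)).mpr ?_)
    rw [F_neg, ← neg_zero, min_neg_neg, neg_sq]
    exact hupper.trans hc
  rw [← neg_div, div_le_iff₀' ha0] at h0
  rw [neg_neg, div_le_iff₀' han] at hn'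
  have h1 : ξ 1 ≤ ξ i := hξ.monotoneOn ⟨le_rfl, hn⟩ ⟨h1i, hi⟩ h1i
  have h2 : ξ i ≤ ξ n := hξ.monotoneOn ⟨h1i, hi⟩ ⟨hn, le_rfl⟩ hi
  rw [abs_le']
  exact ⟨le_max_of_le_right (h2.trans hn'), le_max_of_le_left ((neg_le_neg h1).trans h0)⟩

lemma exp_le_incr_of_E_le (hn : 1 ≤ n)
    (hu : ∀ i ≤ n, u i < u (i + 1)) (ha : ∀ i ≤ n, 0 < a i) (hk : ∀ i ≤ n, 0 < k i)
    (hξ : ∀ i, 1 ≤ i → i < n → ξ i < ξ (i + 1)) {c R : ℝ} (hc : E n u a k d ξ ≤ c)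
    (hR : ∀ i, 1 ≤ i → i ≤ n → |ξ i| ≤ R) {i : ℕ} (hi : i ≤ n) :
    Real.exp (-((c + ∑ i ∈ Finset.Icc 1 n, |d i| * R ^ 2 / 4) / (k i * (u (i + 1) - u i))))
      ≤ incr n a ξ i := by
  have hw : ∀ i ≤ n, 0 < k i * (u (i + 1) - u i) := fun i hi =>
    mul_pos (hk i hi) (sub_pos.mpr (hu i hi))
  have hd : -∑ i ∈ Finset.Icc 1 n, |d i| * R ^ 2 / 4 ≤ ∑ i ∈ Finset.Icc 1 n, d i * ξ i ^ 2 / 4 := by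
    rw [← Finset.sum_neg_distrib]
    refine Finset.sum_le_sum fun i hi => ?_
    obtain ⟨h1, h2⟩ := Finset.mem_Icc.mp hi
    have hsq : ξ i ^ 2 ≤ R ^ 2 := sq_le_sq' (abs_le.mp (hR i h1 h2)).1 (abs_le.mp (hR i h1 h2)).2
    have h3 := mul_le_mul_of_nonneg_left hsq (abs_nonneg (d i))
    have h4 := mul_le_mul_of_nonneg_right (neg_abs_le (d i)) (sq_nonneg (ξ i))
    linarith
  have hle := Finset.single_le_sum
    (f := fun i => k i * (u (i + 1) - u i) * -Real.log (incr n a ξ i))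
    (fun i hi => by
      have hi : i ≤ n := Nat.lt_succ_iff.mp (Finset.mem_range.mp hi)
      exact mul_nonneg (hw i hi).le (neg_nonneg.mpr
        (Real.log_nonpos (incr_pos hn ha hξ hi).le (incr_le_one i))))
    (Finset.mem_range.mpr (Nat.lt_succ_of_le hi))
  rw [E_eq] at hc
  rw [← Real.le_log_iff_exp_le (incr_pos hn ha hξ hi), neg_le, le_div_iff₀' (hw i hi)]
  linarith

end

lemma toSeq_strictMonoOn {n : ℕ} {x : EuclideanSpace ℝ (Fin n)}
    (hx : ∀ i j : Fin n, i < j → x i < x j) : StrictMonoOn (toSeq n x) (Set.Icc 1 n) := by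
  rintro i ⟨h1, h2⟩ j ⟨h3, h4⟩ hij
  rw [toSeq, toSeq, dif_pos (by omega), dif_pos (by omega)]
  exact hx _ _ (Fin.mk_lt_mk.mpr (by omega))

lemma toSeq_succ {n : ℕ} (x : EuclideanSpace ℝ (Fin n)) (i : Fin n) :
    toSeq n x (i + 1) = x i := by
  simp [toSeq]

lemma continuous_toSeq (n i : ℕ) : Continuous fun x => toSeq n x i := by
  unfold toSeq
  split_ifs <;> fun_prop

lemma continuous_incr_toSeq (n : ℕ) (a : ℕ → ℝ) (i : ℕ) :
    Continuous fun x => incr n a (toSeq n x) i := by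
  have h : ∀ i j, Continuous fun x => F (toSeq n x i / a j) := fun i j =>
    F_continuous.comp ((continuous_toSeq n i).div_const _)
  unfold incr
  split_ifs
  · exact continuous_const
  · exact continuous_const.sub (h _ _)
  · exact (h _ _).sub continuous_const
  · exact (h _ _).sub (h _ _)

lemma isCompact_setOf_abs_le_and_le_incr (n : ℕ) (a ε : ℕ → ℝ) (R : ℝ) :
    IsCompact {x : EuclideanSpace ℝ (Fin n) |
      (∀ i, |x i| ≤ R) ∧ ∀ i ≤ n, ε i ≤ incr n a (toSeq n x) i} := by
  have hbox : IsCompact (WithLp.toLp 2 '' (Set.univ.pi fun _ : Fin n => Set.Icc (-R) R)) :=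
    (isCompact_univ_pi fun _ => isCompact_Icc).image (PiLp.continuous_toLp 2 _)
  refine hbox.of_isClosed_subset ?_ ?_
  · simp only [Set.ofPred_and, Set.ofPred_forall]
    refine (isClosed_iInter fun i => isClosed_le (by fun_prop) continuous_const).inter
      (isClosed_iInter fun i => isClosed_iInter fun _ =>
        isClosed_le continuous_const (continuous_incr_toSeq n a i))
  · rintro x ⟨hx, -⟩
    exact ⟨x.ofLp, fun i _ => abs_le.mp (hx i), rfl⟩

lemma lt_of_incr_pos {n : ℕ} {a : ℕ → ℝ} (ha : ∀ i ≤ n, 0 < a i)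
    {x : EuclideanSpace ℝ (Fin n)} (hx : ∀ i ≤ n, 0 < incr n a (toSeq n x) i) :
    ∀ i j : Fin n, i < j → x i < x j := by
  cases n with
  | zero => exact fun i => i.elim0
  | succ m =>
    refine fun i j hij => Fin.strictMono_iff_lt_succ.mpr (fun i => ?_) hij
    have h := hx (i + 1) (by omega)
    rw [incr, if_neg (by omega), if_neg (by omega), sub_pos, F_strictMono.lt_iff_lt,
      div_lt_div_iff_of_pos_right (ha _ (by omega))] at h
    have h1 := toSeq_succ x i.castSucc
    have h2 := toSeq_succ x i.succ
    simp only [Fin.val_castSucc, Fin.val_succ] at h1 h2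
    rwa [h1, h2] at h

/-- Under the coercivity conditions, `E` attains its (finite) global minimum on `Ω`. -/
theorem stmt7 (n : ℕ) (hn : 1 ≤ n) (u a k d : ℕ → ℝ)
    (hu : ∀ i ≤ n, u i < u (i + 1))
    (ha : ∀ i ≤ n, 0 < a i)
    (hk : ∀ i ≤ n, 0 < k i)
    (hS1 : ∀ j, 1 ≤ j → j ≤ n →
      0 ≤ ∑ i ∈ Finset.Icc 1 j, (k (i - 1) / a (i - 1) ^ 2 * (u i - u (i - 1)) + d i))
    (hS2 : ∀ j, 1 ≤ j → j ≤ n →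
      0 ≤ ∑ i ∈ Finset.Icc j n, (k i / a i ^ 2 * (u (i + 1) - u i) + d i)) :
    ∃ x₀ ∈ {x : EuclideanSpace ℝ (Fin n) | ∀ i j : Fin n, i < j → x i < x j},
      IsLeast ((fun x : EuclideanSpace ℝ (Fin n) => E n u a k d (toSeq n x)) ''
          {x | ∀ i j : Fin n, i < j → x i < x j})
        (E n u a k d (toSeq n x₀)) := by
  let x₁ : EuclideanSpace ℝ (Fin n) := WithLp.toLp 2 fun i => (i : ℝ)
  have hx₁ : ∀ i j : Fin n, i < j → x₁ i < x₁ j := fun i j hij => by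
    simpa [x₁] using hij
  set c := E n u a k d (toSeq n x₁)
  let R := max (a 0 * Real.exp (c / (k 0 * (u 1 - u 0))))
    (a n * Real.exp (c / (k n * (u (n + 1) - u n))))
  let ε : ℕ → ℝ := fun i =>
    Real.exp (-((c + ∑ i ∈ Finset.Icc 1 n, |d i| * R ^ 2 / 4) / (k i * (u (i + 1) - u i))))
  let K := {x : EuclideanSpace ℝ (Fin n) |
    (∀ i, |x i| ≤ R) ∧ ∀ i ≤ n, ε i ≤ incr n a (toSeq n x) i}
  have hK : IsCompact K := isCompact_setOf_abs_le_and_le_incr n a ε R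
  have hsub : ∀ x : EuclideanSpace ℝ (Fin n), (∀ i j : Fin n, i < j → x i < x j) →
      E n u a k d (toSeq n x) ≤ c → x ∈ K := by
    intro x hx hxc
    have hmono := toSeq_strictMonoOn hx
    have hR : ∀ i, 1 ≤ i → i ≤ n → |toSeq n x i| ≤ R := fun i h1 h2 =>
      abs_le_of_E_le hn hu ha hk hS1 hS2 hmono hxc h1 h2
    refine ⟨fun i => ?_, fun i hi => ?_⟩
    · rw [← toSeq_succ x i]
      exact hR _ (by omega) (by omega)
    · exact exp_le_incr_of_E_le hn hu ha hk
        (fun i h1 h2 => hmono ⟨h1, h2.le⟩ ⟨by omega, h2⟩ (Nat.lt_succ_self i)) hxc hR hi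
  have hpos : ∀ x ∈ K, ∀ i ≤ n, 0 < incr n a (toSeq n x) i := fun x hx i hi =>
    (Real.exp_pos _).trans_le (hx.2 i hi)
  have hcont : ContinuousOn (fun x => E n u a k d (toSeq n x)) K := by
    simp only [E_eq]
    refine (continuousOn_finsetSum _ fun i hi => ?_).add (continuousOn_finsetSum _ fun i _ => ?_)
    · have hi : i ≤ n := Nat.lt_succ_iff.mp (Finset.mem_range.mp hi)
      exact continuousOn_const.mul ((continuous_incr_toSeq n a i).continuousOn.log
        fun x hx => (hpos x hx i hi).ne').neg
    · exact ((continuous_const.mul ((continuous_toSeq n i).pow 2)).div_const 4).continuousOn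
  obtain ⟨x₀, hx₀, hmin⟩ := hK.exists_isMinOn ⟨x₁, hsub x₁ hx₁ le_rfl⟩ hcont
  have hΩ := lt_of_incr_pos ha (hpos x₀ hx₀)
  refine ⟨x₀, hΩ, ⟨x₀, hΩ, rfl⟩, ?_⟩
  rintro _ ⟨x, hx, rfl⟩
  rcases le_total (E n u a k d (toSeq n x)) c with h | h
  · exact hmin (hsub x hx h)
  · exact le_trans (hmin (hsub x₁ hx₁ le_rfl)) h
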